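/- arXiv:1504.07806 — 12 statements merged into one kernel-verified Lean document; each statement's English description precedes it below -/
import Mathlib

section
/- Let A be a symmetric m-th order n-dimensional real tensor all of whose entries are nonnegative. If A is diagonally dominant, i.e., for every i ∈ {1,...,n} one has |a_{i i ... i}| ≥ ∑_{(i_2,...,i_m) ≠ (i,...,i)} |a_{i i_2 ... i_m}|, then A is doubly nonnegative: all entries of A and all H-eigenvalues of A are nonnegative. -/
open Finset

/-- `(A x^{m-1})_i = \sum_{i_2,...,i_m} a_{i i_2 ... i_m} x_{i_2} ... x_{i_m}`. -/
noncomputable def tmulVec {m n : ℕ} [NeZero m] (A : (Fin m → Fin n) → ℝ)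
    (x : Fin n → ℝ) (i : Fin n) : ℝ :=
  ∑ g : Fin m → Fin n,
    if g 0 = i then A g * ∏ t ∈ Finset.univ.erase (0 : Fin m), x (g t) else 0

/-- λ is an H-eigenvalue of A if A x^{m-1} = λ x^{[m-1]} for some x ≠ 0. -/
def IsHEigenvalue {m n : ℕ} [NeZero m] (A : (Fin m → Fin n) → ℝ) (lam : ℝ) : Prop :=
  ∃ x : Fin n → ℝ, x ≠ 0 ∧ ∀ i, tmulVec A x i = lam * (x i) ^ (m - 1)

/-- A tensor is symmetric if its entries are invariant under permutations of the indices. -/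
def IsSymmetricTensor {m n : ℕ} (A : (Fin m → Fin n) → ℝ) : Prop :=
  ∀ (σ : Equiv.Perm (Fin m)) (g : Fin m → Fin n), A (g ∘ σ) = A g

/-- Doubly nonnegative: all entries and all H-eigenvalues nonnegative. -/
def IsDNN {m n : ℕ} [NeZero m] (A : (Fin m → Fin n) → ℝ) : Prop :=
  (∀ g, 0 ≤ A g) ∧ ∀ lam : ℝ, IsHEigenvalue A lam → 0 ≤ lam

/-- Diagonally dominant: |a_{i...i}| ≥ sum of |a_{i i_2 ... i_m}| over off-diagonal tuples. -/
def IsDiagDominant {m n : ℕ} [NeZero m] (A : (Fin m → Fin n) → ℝ) : Prop :=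
  ∀ i : Fin n,
    ∑ g ∈ Finset.univ.filter (fun g : Fin m → Fin n => g 0 = i ∧ g ≠ fun _ => i), |A g|
      ≤ |A (fun _ => i)|

/-- The coefficient of `A x^{m-1}` splits into its diagonal and off-diagonal parts. -/
lemma tmulVec_eq_diag_add {m n : ℕ} [NeZero m] (A : (Fin m → Fin n) → ℝ)
    (x : Fin n → ℝ) (i : Fin n) :
    tmulVec A x i = A (fun _ => i) * x i ^ (m - 1) +
      ∑ g ∈ Finset.univ.filter (fun g : Fin m → Fin n => g 0 = i ∧ g ≠ fun _ => i),
        A g * ∏ t ∈ Finset.univ.erase (0 : Fin m), x (g t) := by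
  have hmem : (fun _ => i) ∈ Finset.univ.filter (fun g : Fin m → Fin n => g 0 = i) := by simp
  have hfilter : (Finset.univ.filter (fun g : Fin m → Fin n => g 0 = i)).erase (fun _ => i) =
      Finset.univ.filter (fun g : Fin m → Fin n => g 0 = i ∧ g ≠ fun _ => i) := by
    ext g
    simp [and_comm]
  rw [tmulVec, ← Finset.sum_filter, ← Finset.add_sum_erase _ _ hmem, hfilter]
  simp [Finset.prod_const, Finset.card_erase_of_mem]

/-- Gershgorin-type bound: every H-eigenvalue lies within the off-diagonal absolute row sum of
some diagonal entry. -/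
lemma IsHEigenvalue.exists_abs_sub_le {m n : ℕ} [NeZero m] {A : (Fin m → Fin n) → ℝ} {lam : ℝ}
    (h : IsHEigenvalue A lam) :
    ∃ i, |lam - A (fun _ => i)| ≤
      ∑ g ∈ Finset.univ.filter (fun g : Fin m → Fin n => g 0 = i ∧ g ≠ fun _ => i), |A g| := by
  obtain ⟨x, hx, heig⟩ := h
  obtain ⟨j, hj⟩ := Function.ne_iff.mp hx
  obtain ⟨i, -, hmax⟩ := Finset.exists_max_image Finset.univ (fun k => |x k|) ⟨j, mem_univ j⟩
  have hpos : 0 < |x i| := (abs_pos.mpr hj).trans_le (hmax j (mem_univ j))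
  refine ⟨i, le_of_mul_le_mul_right ?_ (pow_pos hpos (m - 1))⟩
  have heq := heig i
  rw [tmulVec_eq_diag_add, ← eq_sub_iff_add_eq', ← sub_mul] at heq
  rw [← abs_pow, ← abs_mul, ← heq, Finset.sum_mul]
  refine (Finset.abs_sum_le_sum_abs _ _).trans (Finset.sum_le_sum fun g _ => ?_)
  rw [abs_mul, Finset.abs_prod, abs_pow]
  gcongr
  refine (Finset.prod_le_prod (fun t _ => abs_nonneg _) fun t _ => hmax _ (mem_univ _)).trans_eq ?_
  simp [Finset.card_erase_of_mem]

/-- a symmetric nonnegative diagonally dominant tensor is doubly nonnegative. -/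
theorem diag_dominant_nonneg_is_DNN (m n : ℕ) [NeZero m] (A : (Fin m → Fin n) → ℝ)
    (hsym : IsSymmetricTensor A) (hnn : ∀ g, 0 ≤ A g)
    (hdd : IsDiagDominant A) : IsDNN A := by
  refine ⟨hnn, fun lam hlam => ?_⟩
  obtain ⟨i, hi⟩ := hlam.exists_abs_sub_le
  have hbound := hi.trans (hdd i)
  rw [abs_of_nonneg (hnn _)] at hbound
  linarith [(abs_le.mp hbound).1]
end

section
/- Let A be an m-th order n-dimensional symmetric tensor with all entries nonnegative and suppose A = B + C, where B = ∑_{k=1}^{r_1} (u^{(k)})^m with u^{(k)} ∈ ℝ^n and C = ∑_{j=1}^{r_2} (v^{(j)})^m with v^{(j)} ∈ ℝ^n_+ (componentwise nonnegative). If there exists an index i_0 ∈ {1,...,n} such that u^{(k)}_{i_0} > 0 for all k ∈ {1,...,r_1}, then A is doubly nonnegative: all entries of A and all H-eigenvalues of A are nonnegative. -/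
open Finset

/-- The contraction of a rank-one tensor: `(w^m x^{m-1})_i = w_i ⟨w, x⟩^{m-1}`. -/
theorem tmulVec_prod {m n : ℕ} [NeZero m] (w x : Fin n → ℝ) (i : Fin n) :
    tmulVec (fun g : Fin m → Fin n => ∏ t, w (g t)) x i = w i * (∑ l, w l * x l) ^ (m - 1) := by
  let f : Fin m → Fin n → ℝ := fun t l =>
    if t = 0 then (if l = i then w l else 0) else w l * x l
  have hsummand : ∀ g : Fin m → Fin n,
      (if g 0 = i then (∏ t, w (g t)) * ∏ t ∈ Finset.univ.erase (0 : Fin m), x (g t) else 0)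
        = ∏ t, f t (g t) := by
    intro g
    have herase : ∏ t ∈ Finset.univ.erase (0 : Fin m), f t (g t)
        = ∏ t ∈ Finset.univ.erase (0 : Fin m), w (g t) * x (g t) :=
      Finset.prod_congr rfl fun t ht => by simp [f, Finset.ne_of_mem_erase ht]
    rw [← Finset.mul_prod_erase _ (fun t => f t (g t)) (Finset.mem_univ (0 : Fin m)),
      ← Finset.mul_prod_erase _ (fun t => w (g t)) (Finset.mem_univ (0 : Fin m)), herase,
      Finset.prod_mul_distrib]
    by_cases h : g 0 = i
    · simp [f, h, mul_assoc]
    · simp [f, h]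
  have hsum : ∏ t, ∑ l, f t l = ∑ g : Fin m → Fin n, ∏ t, f t (g t) := by
    rw [Finset.prod_univ_sum, Fintype.piFinset_univ]
  have herase : ∏ t ∈ Finset.univ.erase (0 : Fin m), ∑ l, f t l = (∑ l, w l * x l) ^ (m - 1) := by
    rw [Finset.prod_congr rfl (g := fun _ => ∑ l, w l * x l)
      fun t ht => by simp [f, Finset.ne_of_mem_erase ht]]
    simp [Finset.card_erase_of_mem]
  unfold tmulVec
  rw [Finset.sum_congr rfl fun g _ => hsummand g, ← hsum,
    ← Finset.mul_prod_erase _ _ (Finset.mem_univ (0 : Fin m)), herase]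
  simp [f]

theorem tmulVec_add {m n : ℕ} [NeZero m] (A B : (Fin m → Fin n) → ℝ) (x : Fin n → ℝ)
    (i : Fin n) : tmulVec (fun g => A g + B g) x i = tmulVec A x i + tmulVec B x i := by
  unfold tmulVec
  rw [← Finset.sum_add_distrib]
  refine Finset.sum_congr rfl fun g _ => ?_
  split_ifs <;> ring

theorem tmulVec_sum {ι : Type*} [Fintype ι] {m n : ℕ} [NeZero m]
    (A : ι → (Fin m → Fin n) → ℝ) (x : Fin n → ℝ) (i : Fin n) :
    tmulVec (fun g => ∑ k, A k g) x i = ∑ k, tmulVec (A k) x i := by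
  unfold tmulVec
  rw [Finset.sum_comm]
  refine Finset.sum_congr rfl fun g _ => ?_
  split_ifs <;> simp [Finset.sum_mul]

/-- Pairing a sum of vectors `c_k w_k`, `c_k = ⟨w_k, x⟩^{m-1}`, with `x`. -/
theorem sum_mul_sum_inner_pow {ι : Type*} [Fintype ι] {m n : ℕ} (hm : m ≠ 0)
    (w : ι → Fin n → ℝ) (x : Fin n → ℝ) :
    ∑ i, x i * ∑ k, w k i * (∑ l, w k l * x l) ^ (m - 1) = ∑ k, (∑ l, w k l * x l) ^ m := by
  simp_rw [Finset.mul_sum]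
  rw [Finset.sum_comm]
  refine Finset.sum_congr rfl fun k _ => ?_
  rw [← mul_pow_sub_one hm, Finset.sum_mul]
  exact Finset.sum_congr rfl fun i _ => by ring

/-- if a nonnegative symmetric tensor A = B + C where B is a sum of m-th
powers of vectors all of whose i_0-th components are positive and C is a sum of m-th
powers of nonnegative vectors, then A is doubly nonnegative. -/
theorem sum_powers_is_DNN (m n : ℕ) [NeZero m] (A : (Fin m → Fin n) → ℝ)
    (hsym : IsSymmetricTensor A) (hnn : ∀ g, 0 ≤ A g)
    (r₁ r₂ : ℕ) (u : Fin r₁ → Fin n → ℝ) (v : Fin r₂ → Fin n → ℝ)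
    (hv : ∀ j i, 0 ≤ v j i)
    (hA : ∀ g, A g = (∑ k, ∏ t, u k (g t)) + ∑ j, ∏ t, v j (g t))
    (i₀ : Fin n) (hu : ∀ k, 0 < u k i₀) :
    IsDNN A := by
  refine ⟨hnn, ?_⟩
  rintro lam ⟨x, hx, heig⟩
  have hm : m ≠ 0 := NeZero.ne m
  obtain ⟨i₁, hi₁⟩ : ∃ i, x i ≠ 0 := Function.ne_iff.mp hx
  have key : ∀ i, (∑ k, u k i * (∑ l, u k l * x l) ^ (m - 1))
      + ∑ j, v j i * (∑ l, v j l * x l) ^ (m - 1) = lam * x i ^ (m - 1) := by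
    intro i
    rw [← heig i, funext hA, tmulVec_add, tmulVec_sum, tmulVec_sum]
    simp only [tmulVec_prod]
  rcases Nat.even_or_odd m with hev | hodd
  · have hpair : (∑ k, (∑ l, u k l * x l) ^ m) + ∑ j, (∑ l, v j l * x l) ^ m
        = lam * ∑ i, x i ^ m := by
      rw [← sum_mul_sum_inner_pow hm, ← sum_mul_sum_inner_pow hm, ← Finset.sum_add_distrib,
        Finset.mul_sum]
      refine Finset.sum_congr rfl fun i _ => ?_
      rw [← mul_add, key i, ← mul_pow_sub_one hm (x i)]
      ring
    have hpos : 0 < ∑ i, x i ^ m :=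
      Finset.sum_pos' (fun i _ => hev.pow_nonneg _) ⟨i₁, Finset.mem_univ _, hev.pow_pos hi₁⟩
    refine nonneg_of_mul_nonneg_left ?_ hpos
    rw [← hpair]
    exact add_nonneg (Finset.sum_nonneg fun k _ => hev.pow_nonneg _)
      (Finset.sum_nonneg fun j _ => hev.pow_nonneg _)
  · have hev : Even (m - 1) := hodd.tsub_odd odd_one
    have hC : ∀ i, 0 ≤ ∑ j, v j i * (∑ l, v j l * x l) ^ (m - 1) := fun i =>
      Finset.sum_nonneg fun j _ => mul_nonneg (hv j i) (hev.pow_nonneg _)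
    have hterm : ∀ k ∈ Finset.univ, 0 ≤ u k i₀ * (∑ l, u k l * x l) ^ (m - 1) := fun k _ =>
      mul_nonneg (hu k).le (hev.pow_nonneg _)
    have hB := Finset.sum_nonneg hterm
    rcases (hev.pow_nonneg (x i₀)).lt_or_eq with hpos | hzero
    · exact nonneg_of_mul_nonneg_left (key i₀ ▸ add_nonneg hB (hC i₀)) hpos
    · have hB0 : ∑ k, u k i₀ * (∑ l, u k l * x l) ^ (m - 1) = 0 := by
        have h := key i₀
        rw [← hzero, mul_zero] at h
        linarith [hC i₀]
      have hu0 : ∀ k, (∑ l, u k l * x l) ^ (m - 1) = 0 := fun k =>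
        (mul_eq_zero.mp ((Finset.sum_eq_zero_iff_of_nonneg hterm).mp hB0 k
          (Finset.mem_univ k))).resolve_left (hu k).ne'
      have h := key i₁
      simp only [hu0, mul_zero, Finset.sum_const_zero, zero_add] at h
      exact nonneg_of_mul_nonneg_left (h ▸ hC i₁) (hev.pow_pos hi₁)
end

section
/- Let A be a symmetric m-th order n-dimensional circulant tensor with all entries nonnegative, with root tensor A_1 (the (m-1)-st order tensor with entries (A_1)_{j_1...j_{m-1}} = a_{1 j_1 ... j_{m-1}}) and diagonal entry c_0 = a_{1...1}. If 2 c_0 − A_1 e^{m-1} ≥ 0, where e is the all-ones vector in ℝ^n and A_1 e^{m-1} = ∑_{j_1,...,j_{m-1} ∈ [n]} (A_1)_{j_1...j_{m-1}}, then A is doubly nonnegative: all entries of A and all H-eigenvalues of A are nonnegative. -/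
open Finset

/-- Circulant tensor: entries invariant under the simultaneous cyclic shift of all indices. -/
def IsCirculant {m n : ℕ} [NeZero n] (A : (Fin m → Fin n) → ℝ) : Prop :=
  ∀ g : Fin m → Fin n, A (fun j => g j + 1) = A g

/-- Induction along the cyclic successor of `Fin n`. -/
theorem Fin.cyclic_induction {n : ℕ} [NeZero n] {P : Fin n → Prop} (zero : P 0)
    (succ : ∀ i, P i → P (i + 1)) (i : Fin n) : P i := by
  obtain _ | n := n
  · exact i.elim0
  · induction i using Fin.induction with
    | zero => exact zero
    | succ i ih => exact Fin.coeSucc_eq_succ (a := i) ▸ succ _ ih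

theorem IsCirculant.apply_const {m n : ℕ} [NeZero n] {A : (Fin m → Fin n) → ℝ}
    (hA : IsCirculant A) (i : Fin n) : A (fun _ => i) = A (fun _ => 0) := by
  induction i using Fin.cyclic_induction with
  | zero => rfl
  | succ i ih => exact (hA fun _ => i).trans ih

theorem IsCirculant.tmulVec_one {m n : ℕ} [NeZero m] [NeZero n] {A : (Fin m → Fin n) → ℝ}
    (hA : IsCirculant A) (i : Fin n) : tmulVec A (fun _ => 1) i = tmulVec A (fun _ => 1) 0 := by
  induction i using Fin.cyclic_induction with
  | zero => rfl
  | succ i ih =>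
    rw [← ih, tmulVec, tmulVec]
    refine (Fintype.sum_equiv (Equiv.arrowCongr (Equiv.refl (Fin m)) (Equiv.addRight (1 : Fin n)))
      _ _ fun g => ?_).symm
    have hg := hA g
    simp only [Equiv.arrowCongr, Equiv.coe_fn_mk, Function.comp_def, Equiv.refl_symm,
      Equiv.refl_apply, Equiv.coe_addRight, add_left_inj, hg]

/-- A Gershgorin estimate: the off-diagonal part of `(A x^{m-1})_i` is bounded by the off-diagonal
row sum times `|x_i|^{m-1}` when `|x_i|` is maximal. -/
theorem abs_tmulVec_sub_le {m n : ℕ} [NeZero m] {A : (Fin m → Fin n) → ℝ}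
    (hA : ∀ g, 0 ≤ A g) {x : Fin n → ℝ} {i : Fin n} (hi : ∀ j, |x j| ≤ |x i|) :
    |tmulVec A x i - A (fun _ => i) * x i ^ (m - 1)| ≤
      (tmulVec A (fun _ => 1) i - A (fun _ => i)) * |x i| ^ (m - 1) := by
  have hcard : #(univ.erase (0 : Fin m)) = m - 1 := by simp
  have split (y : Fin n → ℝ) : tmulVec A y i = A (fun _ => i) * y i ^ (m - 1) +
      ∑ g ∈ univ.erase (fun _ => i),
        if g 0 = i then A g * ∏ t ∈ univ.erase (0 : Fin m), y (g t) else 0 := by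
    rw [tmulVec, ← add_sum_erase _ _ (mem_univ fun _ => i), if_pos rfl, prod_const, hcard]
  rw [split x, split fun _ => 1, one_pow, mul_one, add_sub_cancel_left, add_sub_cancel_left,
    sum_mul]
  refine (abs_sum_le_sum_abs _ _).trans (sum_le_sum fun g _ => ?_)
  split_ifs
  · rw [prod_const_one, mul_one, abs_mul, abs_of_nonneg (hA g), abs_prod, ← hcard, ← prod_const]
    exact mul_le_mul_of_nonneg_left
      (prod_le_prod (fun _ _ => abs_nonneg _) fun t _ => hi (g t)) (hA g)
  · simp

/-- a nonnegative symmetric circulant tensor with 2 c₀ - A₁ e^{m-1} ≥ 0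
is doubly nonnegative.  Here `tmulVec A (fun _ => 1) 0 = A₁ e^{m-1}` is the sum of all
entries of the root tensor and `A (fun _ => 0) = c₀` is the diagonal entry. -/
theorem circulant_diag_dominant_is_DNN (m n : ℕ) [NeZero m] [NeZero n]
    (A : (Fin m → Fin n) → ℝ)
    (hsym : IsSymmetricTensor A) (hnn : ∀ g, 0 ≤ A g) (hcirc : IsCirculant A)
    (hroot : 0 ≤ 2 * A (fun _ => 0) - tmulVec A (fun _ => 1) 0) :
    IsDNN A := by
  refine ⟨hnn, fun lam ⟨x, hx, h⟩ => ?_⟩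
  obtain ⟨i, hi⟩ := Finite.exists_max fun j => |x j|
  have hxi : 0 < |x i| := by
    obtain ⟨j, hj⟩ := Function.ne_iff.mp hx
    exact (abs_pos.mpr hj).trans_le (hi j)
  have key := abs_tmulVec_sub_le hnn hi
  rw [h, hcirc.apply_const, hcirc.tmulVec_one, ← sub_mul, abs_mul, abs_pow] at key
  have hle := le_of_mul_le_mul_right key (pow_pos hxi _)
  linarith [(abs_le.mp hle).1]
end

section
/- Let A be an m-th order n-dimensional circulant tensor with root tensor A_1, the (m-1)-st order n-dimensional tensor with entries (A_1)_{j_1...j_{m-1}} = a_{1 j_1 ... j_{m-1}}. If A_1 is copositive (respectively, strictly copositive), then A is copositive (respectively, strictly copositive). Moreover, if A is doubly circulant, i.e., every row tensor A_k (with entries (A_k)_{j_1...j_{m-1}} = a_{k j_1 ... j_{m-1}}) equals A_1, then A is copositive (respectively, strictly copositive) if and only if A_1 is copositive (respectively, strictly copositive). -/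
open Finset

/-- Copositive: A x^m ≥ 0 for all componentwise nonnegative x. -/
def IsCopositive {m n : ℕ} (A : (Fin m → Fin n) → ℝ) : Prop :=
  ∀ x : Fin n → ℝ, (∀ i, 0 ≤ x i) → 0 ≤ ∑ g : Fin m → Fin n, A g * ∏ t, x (g t)

/-- Strictly copositive: A x^m > 0 for all nonnegative x ≠ 0. -/
def IsStrictlyCopositive {m n : ℕ} (A : (Fin m → Fin n) → ℝ) : Prop :=
  ∀ x : Fin n → ℝ, (∀ i, 0 ≤ x i) → x ≠ 0 → 0 < ∑ g : Fin m → Fin n, A g * ∏ t, x (g t)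

theorem sum_mul_prod_eq_sum_mul_tmulVec {m n : ℕ} [NeZero m] (A : (Fin m → Fin n) → ℝ)
    (x : Fin n → ℝ) :
    ∑ g : Fin m → Fin n, A g * ∏ t, x (g t) = ∑ i, x i * tmulVec A x i := by
  simp only [tmulVec, Finset.mul_sum]
  rw [Finset.sum_comm]
  refine Finset.sum_congr rfl fun g _ => ?_
  simp only [mul_ite, mul_zero, Finset.sum_ite_eq, Finset.mem_univ, if_true]
  rw [← Finset.mul_prod_erase Finset.univ (fun t => x (g t)) (Finset.mem_univ (0 : Fin m))]
  ring

theorem IsCirculant.apply_add {m n : ℕ} [NeZero n] {A : (Fin m → Fin n) → ℝ}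
    (hA : IsCirculant A) (g : Fin m → Fin n) (i : Fin n) : A (fun j => g j + i) = A g := by
  have key (k : ℕ) : A (fun j => g j + Fin.ofNat n k) = A g := by
    induction k with
    | zero =>
      have h : Fin.ofNat n 0 = 0 := rfl
      simp only [h, add_zero]
    | succ k ih =>
      have h : Fin.ofNat n (k + 1) = Fin.ofNat n k + 1 := by
        ext
        simp [Fin.val_add]
      rw [← ih, ← hA fun j => g j + Fin.ofNat n k]
      simp only [h, add_assoc]
  simpa using key i.val

theorem IsCirculant.tmulVec_eq {m n : ℕ} [NeZero m] [NeZero n] {A : (Fin m → Fin n) → ℝ}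
    (hA : IsCirculant A) (x : Fin n → ℝ) (i : Fin n) :
    tmulVec A x i = tmulVec A (fun j => x (j + i)) 0 := by
  refine (Fintype.sum_equiv (Equiv.piCongrRight fun _ : Fin m => Equiv.addRight i) _ _
    fun g => ?_).symm
  have h : A (Equiv.piCongrRight (fun _ : Fin m => Equiv.addRight i) g) = A g :=
    hA.apply_add g i
  simp [h]

theorem tmulVec_eq_of_forall_update {m n : ℕ} [NeZero m] [NeZero n]
    {A : (Fin m → Fin n) → ℝ} (hA : ∀ g, A g = A (Function.update g 0 0))
    (x : Fin n → ℝ) (i : Fin n) : tmulVec A x i = tmulVec A x 0 := by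
  refine (Fintype.sum_equiv (Equiv.piCongrRight fun t : Fin m =>
    if t = 0 then Equiv.addRight i else Equiv.refl _) _ _ fun g => ?_).symm
  set e := Equiv.piCongrRight fun t : Fin m =>
    if t = 0 then Equiv.addRight i else Equiv.refl (Fin n)
  have h0 : e g 0 = g 0 + i := by simp [e]
  have hne : ∀ t, t ≠ 0 → e g t = g t := fun t ht => by simp [e, ht]
  have hAe : A (e g) = A g := by
    rw [hA, hA g]
    congr 1
    ext t : 1
    by_cases ht : t = 0
    · subst ht; simp
    · simp [ht, hne t ht]
  have hp : ∏ t ∈ Finset.univ.erase (0 : Fin m), x (e g t) =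
      ∏ t ∈ Finset.univ.erase (0 : Fin m), x (g t) :=
    Finset.prod_congr rfl fun t ht => by rw [hne t (Finset.ne_of_mem_erase ht)]
  simp [h0, hAe, hp]

theorem tmulVec_zero_nonneg {m n : ℕ} [NeZero m] {A : (Fin m → Fin n) → ℝ} {i : Fin n}
    (y : Fin n → ℝ) (hy : 0 ≤ tmulVec A y i) : 0 ≤ tmulVec A 0 i := by
  rcases (Finset.univ.erase (0 : Fin m)).eq_empty_or_nonempty with h | ⟨t, ht⟩
  · simpa [tmulVec, h] using hy
  · refine (Finset.sum_eq_zero fun g _ => ?_).ge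
    rw [Finset.prod_eq_zero ht rfl, mul_zero, ite_self]

theorem sum_pos_of_nonneg_of_ne_zero {n : ℕ} {x : Fin n → ℝ} (hx : ∀ i, 0 ≤ x i)
    (hx0 : x ≠ 0) : 0 < ∑ i, x i :=
  Fintype.sum_pos (lt_of_le_of_ne hx hx0.symm)

/-- for a circulant tensor A with root tensor A₁ (so that
`tmulVec A x 0 = A₁ x^{m-1}`), copositivity (resp. strict copositivity) of A₁ implies
that of A; and if A is doubly circulant (all row tensors equal the root tensor), then
A is copositive (resp. strictly copositive) iff A₁ is. -/
theorem circulant_copositive (m n : ℕ) [NeZero m] [NeZero n]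
    (A : (Fin m → Fin n) → ℝ) (hcirc : IsCirculant A) :
    ((∀ x : Fin n → ℝ, (∀ i, 0 ≤ x i) → 0 ≤ tmulVec A x 0) → IsCopositive A) ∧
    ((∀ x : Fin n → ℝ, (∀ i, 0 ≤ x i) → x ≠ 0 → 0 < tmulVec A x 0) →
      IsStrictlyCopositive A) ∧
    ((∀ g : Fin m → Fin n, A g = A (Function.update g 0 0)) →
      ((IsCopositive A ↔ ∀ x : Fin n → ℝ, (∀ i, 0 ≤ x i) → 0 ≤ tmulVec A x 0) ∧
       (IsStrictlyCopositive A ↔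
         ∀ x : Fin n → ℝ, (∀ i, 0 ≤ x i) → x ≠ 0 → 0 < tmulVec A x 0))) := by
  have hpos : (∀ x : Fin n → ℝ, (∀ i, 0 ≤ x i) → 0 ≤ tmulVec A x 0) → IsCopositive A := by
    intro h x hx
    rw [sum_mul_prod_eq_sum_mul_tmulVec]
    refine Finset.sum_nonneg fun i _ => mul_nonneg (hx i) ?_
    rw [hcirc.tmulVec_eq]
    exact h _ fun j => hx _
  have hspos : (∀ x : Fin n → ℝ, (∀ i, 0 ≤ x i) → x ≠ 0 → 0 < tmulVec A x 0) →
      IsStrictlyCopositive A := by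
    intro h x hx hx0
    rw [sum_mul_prod_eq_sum_mul_tmulVec]
    have hrow (i : Fin n) : 0 < tmulVec A x i := by
      rw [hcirc.tmulVec_eq]
      refine h _ (fun j => hx _) fun h0 => hx0 (funext fun j => ?_)
      simpa using congrFun h0 (j - i)
    obtain ⟨i, hi⟩ := Function.ne_iff.mp hx0
    exact Finset.sum_pos' (fun j _ => mul_nonneg (hx j) (hrow j).le)
      ⟨i, Finset.mem_univ i, mul_pos (lt_of_le_of_ne (hx i) (Ne.symm hi)) (hrow i)⟩
  refine ⟨hpos, hspos, fun hd => ?_⟩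
  have hfac (x : Fin n → ℝ) :
      ∑ g : Fin m → Fin n, A g * ∏ t, x (g t) = (∑ i, x i) * tmulVec A x 0 := by
    rw [sum_mul_prod_eq_sum_mul_tmulVec, Finset.sum_mul]
    exact Finset.sum_congr rfl fun i _ => by rw [tmulVec_eq_of_forall_update hd]
  refine ⟨⟨fun h => ?_, hpos⟩, ⟨fun h x hx hx0 => ?_, hspos⟩⟩
  · have hne (x : Fin n → ℝ) (hx : ∀ i, 0 ≤ x i) (hx0 : x ≠ 0) : 0 ≤ tmulVec A x 0 :=
      nonneg_of_mul_nonneg_right ((h x hx).trans_eq (hfac x)) (sum_pos_of_nonneg_of_ne_zero hx hx0)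
    intro x hx
    by_cases hx0 : x = 0
    · subst hx0
      exact tmulVec_zero_nonneg 1 (hne 1 (fun _ => zero_le_one) one_ne_zero)
    · exact hne x hx hx0
  · exact pos_of_mul_pos_right ((h x hx hx0).trans_eq (hfac x))
      (sum_pos_of_nonneg_of_ne_zero hx hx0).le
end

section
/- Let m ≥ 3 and let G = (V, E) be an m-uniform hypergraph on vertex set V = {1,...,n} whose edge set E is nonempty (each edge is a set of m distinct vertices). Then the signless Laplacian tensor Q = D + A of G is not completely positive. -/
open Finset

/-- Completely positive: a sum of m-th powers of nonnegative vectors. -/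
def IsCP {m n : ℕ} (A : (Fin m → Fin n) → ℝ) : Prop :=
  ∃ (r : ℕ) (u : Fin r → Fin n → ℝ),
    (∀ k i, 0 ≤ u k i) ∧ ∀ g, A g = ∑ k, ∏ t, u k (g t)

/-- A completely positive tensor which is positive at `g` is positive at `g ∘ s` for every
self-map `s` of the positions. -/
theorem IsCP.comp_pos {m n : ℕ} {A : (Fin m → Fin n) → ℝ} (hA : IsCP A) {g : Fin m → Fin n}
    (hg : 0 < A g) (s : Fin m → Fin m) : 0 < A (g ∘ s) := by
  obtain ⟨r, u, hu, hA⟩ := hA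
  rw [hA] at hg ⊢
  obtain ⟨k, -, hk⟩ := Finset.exists_lt_of_sum_lt (f := fun _ => (0 : ℝ)) (by simpa using hg)
  have hpos : ∀ t, 0 < u k (g t) := fun t =>
    (hu k (g t)).lt_of_ne' (Finset.prod_ne_zero_iff.mp hk.ne' t (Finset.mem_univ t))
  exact Finset.sum_pos' (fun _ _ => Finset.prod_nonneg fun _ _ => hu _ _)
    ⟨k, Finset.mem_univ k, Finset.prod_pos fun t _ => hpos (s t)⟩

/-- for m ≥ 3, the signless Laplacian tensor Q = D + A of a nonempty
m-uniform hypergraph is not completely positive. -/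
theorem signless_laplacian_not_CP (m n : ℕ) [NeZero m] (hm : 3 ≤ m)
    (E : Finset (Finset (Fin n))) (hE : E.Nonempty) (hcard : ∀ e ∈ E, e.card = m) :
    ¬ IsCP (fun g : Fin m → Fin n =>
      (if ∀ j, g j = g 0 then ((E.filter (fun e => g 0 ∈ e)).card : ℝ) else 0) +
      (if Finset.image g Finset.univ ∈ E then 1 / ((m - 1).factorial : ℝ) else 0)) := by
  intro hcp
  obtain ⟨e, he⟩ := hE
  have hinj : Function.Injective (e.orderEmbOfFin (hcard e he)) :=
    (e.orderEmbOfFin (hcard e he)).injective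
  have himg : Finset.image (e.orderEmbOfFin (hcard e he)) Finset.univ = e :=
    Finset.image_orderEmbOfFin_univ e (hcard e he)
  generalize (e.orderEmbOfFin (hcard e he) : Fin m → Fin n) = g at hinj himg
  have h10 : (⟨1, by omega⟩ : Fin m) ≠ 0 := by simp [Fin.ext_iff]
  have h := hcp.comp_pos (g := g) (by
    simp only [himg, if_pos he]
    positivity) (Function.update id ⟨1, by omega⟩ 0)
  have hconst : ¬ ∀ j, (g ∘ Function.update id ⟨1, by omega⟩ 0) j =
      (g ∘ Function.update id ⟨1, by omega⟩ 0) 0 := fun hc => by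
    have := hinj (hc ⟨2, by omega⟩)
    simp [h10.symm] at this
  have hedge : Finset.image (g ∘ Function.update id ⟨1, by omega⟩ 0) Finset.univ ∉ E := fun hc => by
    have hinj' := Finset.card_image_iff.mp ((hcard _ hc).trans (Finset.card_fin m).symm)
    refine h10 (hinj' (by simp) (by simp) ?_)
    simp
  simp only [if_neg hconst, if_neg hedge, add_zero, lt_irrefl] at h
end

section
/- Let A be an m-th order n-dimensional strongly completely positive tensor, i.e., A = ∑_{k=1}^r (u^{(k)})^m with u^{(k)} ∈ ℝ^n_+ for all k and span{u^{(1)},...,u^{(r)}} = ℝ^n. Then every H-eigenvalue of A is positive: whenever λ ∈ ℝ and x ∈ ℝ^n \ {0} satisfy A x^{m-1} = λ x^{[m-1]}, one has λ > 0. -/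
open Finset

/-- Strongly completely positive: a sum of m-th powers of nonnegative vectors spanning ℝ^n. -/
def IsSCP {m n : ℕ} (A : (Fin m → Fin n) → ℝ) : Prop :=
  ∃ (r : ℕ) (u : Fin r → Fin n → ℝ),
    (∀ k i, 0 ≤ u k i) ∧ (∀ g, A g = ∑ k, ∏ t, u k (g t)) ∧
    Submodule.span ℝ (Set.range u) = ⊤

/-- For `A = ∑ k, (u k)^m`, one has `A x^{m-1} = ∑ k, (u k ⬝ x)^{m-1} u k`. -/
lemma tmulVec_sum_pow {m n r : ℕ} [NeZero m] {A : (Fin m → Fin n) → ℝ} {u : Fin r → Fin n → ℝ}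
    (hA : ∀ g, A g = ∑ k, ∏ t, u k (g t)) (x : Fin n → ℝ) (i : Fin n) :
    tmulVec A x i = ∑ k, u k i * (u k ⬝ᵥ x) ^ (m - 1) := by
  obtain ⟨p, rfl⟩ := Nat.exists_eq_succ_of_ne_zero (NeZero.ne m)
  have herase (y : Fin (p + 1) → ℝ) :
      ∏ t ∈ Finset.univ.erase (0 : Fin (p + 1)), y t = ∏ t : Fin p, y t.succ := by
    rw [Fin.univ_succ, Finset.erase_cons, Finset.prod_map]
    rfl
  have hsplit : tmulVec A x i =
      ∑ h : Fin p → Fin n, A (Fin.cons i h) * ∏ t, x (h t) := by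
    unfold tmulVec
    rw [← (Fin.consEquiv fun _ : Fin (p + 1) => Fin n).sum_comp, Fintype.sum_prod_type]
    rw [Finset.sum_eq_single i]
    · refine Finset.sum_congr rfl fun h _ => ?_
      have hc : (Fin.cons i h : Fin (p + 1) → Fin n) 0 = i := rfl
      simp only [Fin.consEquiv_apply]
      rw [if_pos hc]
      congr 1
      exact herase fun t => x ((Fin.cons i h : Fin (p + 1) → Fin n) t)
    · intro j _ hj
      refine Finset.sum_eq_zero fun h _ => if_neg hj
    · simp
  rw [hsplit]
  simp only [hA, Finset.sum_mul]
  rw [Finset.sum_comm]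
  refine Finset.sum_congr rfl fun k _ => ?_
  simp only [Nat.succ_eq_add_one, Nat.add_sub_cancel, dotProduct, Fintype.sum_pow, Finset.mul_sum]
  refine Finset.sum_congr rfl fun h _ => ?_
  rw [Fin.prod_univ_succ, Finset.prod_mul_distrib]
  simp [mul_assoc]

/-- A vector orthogonal to a spanning family vanishes. -/
lemma eq_zero_of_forall_dotProduct_eq_zero {ι n : Type*} [Fintype n] {u : ι → n → ℝ}
    (hu : Submodule.span ℝ (Set.range u) = ⊤) {x : n → ℝ} (h : ∀ k, u k ⬝ᵥ x = 0) : x = 0 := by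
  rw [← dotProduct_self_eq_zero]
  have hx : x ∈ Submodule.span ℝ (Set.range u) := hu ▸ Submodule.mem_top
  refine Submodule.span_induction (p := fun y _ => y ⬝ᵥ x = 0) ?_ (zero_dotProduct x) ?_ ?_ hx
  · rintro _ ⟨k, rfl⟩
    exact h k
  · intro y z _ _ hy hz
    rw [add_dotProduct, hy, hz, add_zero]
  · intro c y _ hy
    rw [smul_dotProduct, hy, smul_zero]

/-- every H-eigenvalue of a strongly completely positive tensor is positive. -/
theorem SCP_Heigenvalues_pos (m n : ℕ) [NeZero m] (A : (Fin m → Fin n) → ℝ)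
    (hscp : IsSCP A) (lam : ℝ) (hlam : IsHEigenvalue A lam) : 0 < lam := by
  obtain ⟨r, u, hu0, hA, hspan⟩ := hscp
  obtain ⟨x, hx, hev⟩ := hlam
  simp only [tmulVec_sum_pow hA] at hev
  have hm : m ≠ 0 := NeZero.ne m
  obtain ⟨k, hk⟩ : ∃ k, u k ⬝ᵥ x ≠ 0 := by
    by_contra! h
    exact hx (eq_zero_of_forall_dotProduct_eq_zero hspan h)
  rcases Nat.even_or_odd m with he | ho
  · have hsum : ∑ k, (u k ⬝ᵥ x) ^ m = lam * ∑ i, x i ^ m := by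
      have hpow (a : ℝ) : a ^ m = a * a ^ (m - 1) := (mul_pow_sub_one hm a).symm
      calc ∑ k, (u k ⬝ᵥ x) ^ m
          = ∑ k, ∑ i, x i * (u k i * (u k ⬝ᵥ x) ^ (m - 1)) := by
            refine Finset.sum_congr rfl fun k _ => ?_
            rw [hpow]
            nth_rewrite 1 [dotProduct]
            rw [Finset.sum_mul]
            exact Finset.sum_congr rfl fun i _ => by ring
        _ = ∑ i, x i * ∑ k, u k i * (u k ⬝ᵥ x) ^ (m - 1) := by
            rw [Finset.sum_comm]
            simp only [Finset.mul_sum]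
        _ = lam * ∑ i, x i ^ m := by
            rw [Finset.mul_sum]
            refine Finset.sum_congr rfl fun i _ => ?_
            rw [hev, hpow]
            ring
    have hpos : 0 < ∑ k, (u k ⬝ᵥ x) ^ m :=
      Finset.sum_pos' (fun k _ => he.pow_nonneg _) ⟨k, Finset.mem_univ k, he.pow_pos hk⟩
    rw [hsum] at hpos
    exact pos_of_mul_pos_left hpos (Finset.sum_nonneg fun i _ => he.pow_nonneg _)
  · have he : Even (m - 1) := ho.tsub_odd odd_one
    have hterm (i k) : 0 ≤ u k i * (u k ⬝ᵥ x) ^ (m - 1) := mul_nonneg (hu0 k i) (he.pow_nonneg _)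
    obtain ⟨j, hj⟩ : ∃ j, u k j ≠ 0 := by
      by_contra! h
      exact hk (by simp [dotProduct, h])
    have hpos : 0 < lam * x j ^ (m - 1) := by
      rw [← hev]
      exact Finset.sum_pos' (fun k _ => hterm j k) ⟨k, Finset.mem_univ k,
        mul_pos ((hu0 k j).lt_of_ne' hj) (he.pow_pos hk)⟩
    exact pos_of_mul_pos_left hpos (he.pow_nonneg _)
end

section
/- Let A and B be m-th order n-dimensional symmetric tensors. If A and B are both strongly completely positive, then their Hadamard (entrywise) product A ∘ B, with entries (A ∘ B)_{i_1...i_m} = a_{i_1...i_m} b_{i_1...i_m}, is strongly completely positive. -/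
open Finset

/-- Pointwise products of two families spanning a unital algebra span it as well. -/
theorem span_range_mul_eq_top {R S ι κ : Type*} [CommSemiring R] [Semiring S] [Algebra R S]
    {u : ι → S} {v : κ → S} (hu : Submodule.span R (Set.range u) = ⊤)
    (hv : Submodule.span R (Set.range v) = ⊤) :
    Submodule.span R (Set.range fun p : ι × κ => u p.1 * v p.2) = ⊤ := by
  have hrange : (Set.range fun p : ι × κ => u p.1 * v p.2) =
      {x | ∃ a ∈ Set.range u, ∃ b ∈ Set.range v, a * b = x} := by
    ext x
    simp
  have hmul := Submodule.span_mul_span R (Set.range u) (Set.range v)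
  rw [hu, hv] at hmul
  rw [hrange]
  refine hmul.symm.trans (eq_top_iff.2 fun x _ => ?_)
  simpa using Submodule.mul_mem_mul (Submodule.mem_top (R := R) (x := x))
    (Submodule.mem_top (R := R) (x := (1 : S)))

/-- the Hadamard product of two strongly completely positive tensors
is strongly completely positive. -/
theorem hadamard_SCP (m n : ℕ) (A B : (Fin m → Fin n) → ℝ)
    (hsymA : IsSymmetricTensor A) (hsymB : IsSymmetricTensor B)
    (hA : IsSCP A) (hB : IsSCP B) :
    IsSCP (fun g => A g * B g) := by
  obtain ⟨r, u, hu, hAu, hspanu⟩ := hA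
  obtain ⟨s, v, hv, hBv, hspanv⟩ := hB
  let e : Fin (r * s) ≃ Fin r × Fin s := finProdFinEquiv.symm
  let w : Fin r × Fin s → Fin n → ℝ := fun p => u p.1 * v p.2
  refine ⟨r * s, w ∘ e, fun k i => mul_nonneg (hu _ i) (hv _ i), fun g => ?_, ?_⟩
  · calc A g * B g = ∑ p : Fin r × Fin s, ∏ t, w p (g t) := by
          rw [hAu, hBv, Finset.sum_mul_sum, Fintype.sum_prod_type]
          simp only [w, Pi.mul_apply, Finset.prod_mul_distrib]
      _ = ∑ k, ∏ t, (w ∘ e) k (g t) :=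
          (Equiv.sum_comp e fun p => ∏ t, w p (g t)).symm
  · rw [e.surjective.range_comp]
    exact span_range_mul_eq_top hspanu hspanv
end

section
/- Suppose m is even. An m-th order n-dimensional symmetric tensor A is both completely positive and positive definite (i.e., A x^m > 0 for all x ∈ ℝ^n \ {0}) if and only if A is strongly completely positive. -/
open Finset

/-- The form of a sum of `m`-th powers of vectors is the sum of `m`-th powers of linear forms. -/
lemma sum_mul_prod_eq_sum_dotProduct_pow {m n r : ℕ} {A : (Fin m → Fin n) → ℝ}
    {u : Fin r → Fin n → ℝ} (hA : ∀ g, A g = ∑ k, ∏ t, u k (g t)) (x : Fin n → ℝ) :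
    ∑ g : Fin m → Fin n, A g * ∏ t, x (g t) = ∑ k, (u k ⬝ᵥ x) ^ m := by
  simp_rw [hA, Finset.sum_mul, ← Finset.prod_mul_distrib]
  rw [Finset.sum_comm]
  refine Finset.sum_congr rfl fun k _ => ?_
  simp only [dotProduct]
  rw [Fintype.sum_pow]

/-- A family of vectors spans `ℝ^n` iff only the zero vector is orthogonal to all of them. -/
lemma span_range_eq_top_iff_forall_dotProduct {ι : Type*} {n : ℕ} (u : ι → Fin n → ℝ) :
    Submodule.span ℝ (Set.range u) = ⊤ ↔ ∀ x, (∀ k, u k ⬝ᵥ x = 0) → x = 0 := by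
  constructor
  · intro h x hx
    have hle : Submodule.span ℝ (Set.range u) ≤ LinearMap.ker (dotProductEquiv ℝ (Fin n) x) := by
      rw [Submodule.span_le]
      rintro _ ⟨k, rfl⟩
      simpa [dotProduct_comm] using hx k
    rw [h, top_le_iff, LinearMap.ker_eq_top] at hle
    simpa using hle
  · intro h
    by_contra hne
    obtain ⟨f, hf, hle⟩ := Submodule.exists_le_ker_of_lt_top _ (lt_top_iff_ne_top.2 hne)
    obtain ⟨x, rfl⟩ := (dotProductEquiv ℝ (Fin n)).surjective f
    refine hf ?_
    rw [h x fun k => ?_, map_zero]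
    have := hle (Submodule.subset_span ⟨k, rfl⟩)
    simpa [dotProduct_comm] using this

/-- for even m, a symmetric tensor is completely positive and positive
definite iff it is strongly completely positive. -/
theorem CP_and_PD_iff_SCP (m n : ℕ) [NeZero m] (hm : Even m)
    (A : (Fin m → Fin n) → ℝ) (hsym : IsSymmetricTensor A) :
    (IsCP A ∧ ∀ x : Fin n → ℝ, x ≠ 0 → 0 < ∑ g : Fin m → Fin n, A g * ∏ t, x (g t)) ↔
      IsSCP A := by
  constructor
  · rintro ⟨⟨r, u, hu, hA⟩, hpos⟩
    refine ⟨r, u, hu, hA, (span_range_eq_top_iff_forall_dotProduct u).2 fun x hx => ?_⟩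
    by_contra hne
    have h := hpos x hne
    rw [sum_mul_prod_eq_sum_dotProduct_pow hA] at h
    simp [hx, NeZero.ne m] at h
  · rintro ⟨r, u, hu, hA, hspan⟩
    refine ⟨⟨r, u, hu, hA⟩, fun x hne => ?_⟩
    rw [sum_mul_prod_eq_sum_dotProduct_pow hA]
    obtain ⟨k, hk⟩ : ∃ k, u k ⬝ᵥ x ≠ 0 := by
      by_contra! hx
      exact hne ((span_range_eq_top_iff_forall_dotProduct u).1 hspan x hx)
    exact Finset.sum_pos' (fun i _ => hm.pow_nonneg _) ⟨k, Finset.mem_univ k, hm.pow_pos hk⟩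
end

section
/- Let A be an m-th order n-dimensional copositive tensor and suppose there exists x ∈ ℝ^n with all components positive such that A x^m = 0. Then A x^{m-1} = 0 (as a vector in ℝ^n), and the n×n symmetric matrix A x^{m-2}, with entries (A x^{m-2})_{ij} = ∑_{i_3,...,i_m ∈ [n]} a_{i j i_3...i_m} x_{i_3}···x_{i_m}, is positive semidefinite. -/
open Finset

/-- Derivative along the line `x + s u` of the form `∑ g, h g * ∏ t ∈ S, y (g t)`, when `h` is
invariant under transpositions of slots in `S`: all slots contribute equally. -/
lemma hasDerivAt_sum_mul_prod_line {m n : ℕ} (h : (Fin m → Fin n) → ℝ) (S : Finset (Fin m))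
    {r : Fin m} (hr : r ∈ S) (hh : ∀ t ∈ S, ∀ g, h (g ∘ Equiv.swap r t) = h g)
    (x u : Fin n → ℝ) (s : ℝ) :
    HasDerivAt (fun s : ℝ => ∑ g : Fin m → Fin n, h g * ∏ t ∈ S, (x (g t) + s * u (g t)))
      (#S * ∑ g : Fin m → Fin n, h g * u (g r) * ∏ t ∈ S.erase r, (x (g t) + s * u (g t))) s := by
  have key : ∀ t ∈ S,
      ∑ g : Fin m → Fin n, h g * u (g t) * ∏ k ∈ S.erase t, (x (g k) + s * u (g k)) =
      ∑ g : Fin m → Fin n, h g * u (g r) * ∏ k ∈ S.erase r, (x (g k) + s * u (g k)) := by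
    intro t ht
    refine Fintype.sum_equiv (Equiv.arrowCongr (Equiv.swap r t) (Equiv.refl _)) _ _ fun g => ?_
    have hg : (Equiv.arrowCongr (Equiv.swap r t) (Equiv.refl _)) g = g ∘ Equiv.swap r t := by
      ext k; simp
    rw [hg, hh t ht g, Function.comp_apply, Equiv.swap_apply_left]
    congr 1
    refine Finset.prod_equiv (Equiv.swap r t) (fun k => ?_) fun k _ => by simp
    simp only [Finset.mem_erase, Equiv.swap_apply_def]
    grind
  have hd : ∀ g : Fin m → Fin n,
      HasDerivAt (fun s : ℝ => h g * ∏ t ∈ S, (x (g t) + s * u (g t)))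
        (∑ t ∈ S, h g * u (g t) * ∏ k ∈ S.erase t, (x (g k) + s * u (g k))) s := by
    intro g
    have hp := HasDerivAt.fun_finsetProd (u := S) (x := s)
      (f := fun t (s : ℝ) => x (g t) + s * u (g t)) (f' := fun t => u (g t))
      fun t _ => by simpa using ((hasDerivAt_id s).mul_const (u (g t))).const_add (x (g t))
    refine (hp.const_mul (h g)).congr_deriv ?_
    rw [Finset.mul_sum]
    exact Finset.sum_congr rfl fun t _ => by rw [smul_eq_mul]; ring
  refine (HasDerivAt.fun_sum (u := Finset.univ) fun g _ => hd g).congr_deriv ?_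
  rw [Finset.sum_comm, Finset.sum_congr rfl key, Finset.sum_const, nsmul_eq_mul]

/-- A strictly negative second derivative is impossible at a local minimum. -/
lemma IsLocalMin.deriv_deriv_nonneg {f : ℝ → ℝ} {a : ℝ} (hf : IsLocalMin f a)
    (hc : ContinuousAt f a) : 0 ≤ deriv (deriv f) a := by
  by_contra! hneg
  have hmax : IsLocalMax f a := by
    have := isLocalMin_of_deriv_deriv_pos (f := -f) (x₀ := a)
      (by simpa [deriv.neg'] using hneg) (by simp [deriv.neg, hf.deriv_eq_zero]) hc.neg
    simpa using this.neg
  have hconst : f =ᶠ[nhds a] fun _ => f a := by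
    filter_upwards [hf, hmax] with y h₁ h₂ using le_antisymm h₂ h₁
  have := hconst.deriv.deriv_eq
  simp at this
  linarith

/-- if A is a symmetric copositive tensor (m ≥ 2) and A x^m = 0 for some
positive vector x, then A x^{m-1} = 0 and the matrix A x^{m-2} is positive semidefinite. -/
theorem copositive_zero_on_positive (m n : ℕ) [NeZero m] (hm : 2 ≤ m)
    (A : (Fin m → Fin n) → ℝ) (hsym : IsSymmetricTensor A) (hcop : IsCopositive A)
    (x : Fin n → ℝ) (hx : ∀ i, 0 < x i)
    (hAx : ∑ g : Fin m → Fin n, A g * ∏ t, x (g t) = 0) :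
    (∀ i, tmulVec A x i = 0) ∧
    (∀ u : Fin n → ℝ, 0 ≤ ∑ i, ∑ j, u i *
      (∑ g ∈ Finset.univ.filter (fun g : Fin m → Fin n => g 0 = i ∧ g 1 = j),
        A g * ∏ t ∈ (Finset.univ.erase (0 : Fin m)).erase 1, x (g t)) * u j) := by
  have h01 : (1 : Fin m) ≠ 0 := by
    intro h
    have := congrArg Fin.val h
    simp [Nat.mod_eq_of_lt (show 1 < m by omega)] at this
  have hm0 : (m : ℝ) ≠ 0 := by exact_mod_cast NeZero.ne m
  have hmin : ∀ u : Fin n → ℝ, IsLocalMin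
      (fun s : ℝ => ∑ g : Fin m → Fin n, A g * ∏ t, (x (g t) + s * u (g t))) 0 := by
    intro u
    have hpos : ∀ᶠ s : ℝ in nhds 0, ∀ i, 0 < x i + s * u i := by
      refine Filter.eventually_all.2 fun i => ?_
      have hc : ContinuousAt (fun s : ℝ => x i + s * u i) 0 := by fun_prop
      exact hc.eventually (lt_mem_nhds (by simpa using hx i))
    filter_upwards [hpos] with s hs
    simpa [hAx] using hcop (fun i => x i + s * u i) fun i => (hs i).le
  have hd₁ (u : Fin n → ℝ) (s : ℝ) :=
    hasDerivAt_sum_mul_prod_line A Finset.univ (Finset.mem_univ 0) (fun t _ g => hsym _ g) x u s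
  have hd₂ (u : Fin n → ℝ) (s : ℝ) :=
    hasDerivAt_sum_mul_prod_line (fun g => A g * u (g 0)) (Finset.univ.erase 0) (r := 1)
      (by simpa using h01)
      (fun t ht g => by
        have ht0 : t ≠ 0 := by simpa using ht
        rw [hsym (Equiv.swap 1 t) g, Function.comp_apply,
          Equiv.swap_apply_of_ne_of_ne h01.symm ht0.symm]) x u s
  refine ⟨fun i => ?_, fun u => ?_⟩
  · have h := (hmin (Pi.single i 1)).hasDerivAt_eq_zero (hd₁ (Pi.single i 1) 0)
    simp only [Finset.card_univ, Fintype.card_fin, mul_eq_zero, hm0, false_or, zero_mul,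
      add_zero] at h
    refine Eq.trans ?_ h
    unfold tmulVec
    refine Finset.sum_congr rfl fun g _ => ?_
    by_cases hg : g 0 = i <;> simp [hg]
  · have hdd := (hmin u).deriv_deriv_nonneg (hd₁ u 0).continuousAt
    rw [funext fun s => (hd₁ u s).deriv, ((hd₂ u 0).const_mul _).deriv] at hdd
    have hcard : (0 : ℝ) < #(Finset.univ.erase (0 : Fin m)) := by
      exact_mod_cast Finset.card_pos.2 ⟨1, by simpa using h01⟩
    have hcard' : (0 : ℝ) < #(Finset.univ : Finset (Fin m)) := by
      exact_mod_cast Finset.card_pos.2 ⟨0, Finset.mem_univ _⟩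
    have hq := nonneg_of_mul_nonneg_right (nonneg_of_mul_nonneg_right hdd hcard') hcard
    refine hq.trans_eq (Eq.symm ?_)
    simp only [zero_mul, add_zero, Finset.sum_filter, Finset.mul_sum, Finset.sum_mul]
    rw [Finset.sum_congr rfl fun i _ => Finset.sum_comm, Finset.sum_comm]
    refine Finset.sum_congr rfl fun g _ => ?_
    rw [Finset.sum_eq_single (g 0) (fun i _ hi => ?_) (by simp),
      Finset.sum_eq_single (g 1) (fun j _ hj => ?_) (by simp)]
    · simp only [and_self, if_true]
      ring
    · simp [hj.symm]
    · simp [hi.symm]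
end

section
/- A rank-one symmetric tensor A = λ x^m (with λ ∈ ℝ, x ∈ ℝ^n, and entries a_{i_1...i_m} = λ x_{i_1}···x_{i_m}) is completely positive if and only if all of its entries are nonnegative. -/
open Finset

/-- a rank-one symmetric tensor λ x^m is completely positive iff all its
entries are nonnegative. -/
theorem rank_one_CP_iff_nonneg (m n : ℕ) [NeZero m] (lam : ℝ) (x : Fin n → ℝ) :
    IsCP (fun g : Fin m → Fin n => lam * ∏ t, x (g t)) ↔
      ∀ g : Fin m → Fin n, 0 ≤ lam * ∏ t, x (g t) := by
  constructor
  · rintro ⟨r, u, hu, hA⟩ g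
    exact (sum_nonneg fun k _ => prod_nonneg fun t _ => hu k (g t)).trans_eq (hA g).symm
  · intro h
    refine ⟨1, fun _ i => |lam| ^ (m : ℝ)⁻¹ * |x i|, fun _ i => by positivity, fun g => ?_⟩
    rw [Fin.sum_univ_one, prod_mul_distrib, prod_const, card_univ, Fintype.card_fin,
      Real.rpow_inv_natCast_pow (abs_nonneg lam) (NeZero.ne m), ← abs_prod, ← abs_mul,
      abs_of_nonneg (h g)]
end

section
/- Let m ≥ 3, n ≥ 2, let i, j ∈ {1,...,n} with i ≠ j, and let α > 0. Then the symmetric tensor A = α (e^{(i)} − e^{(j)})^m + α e^m, where e^{(i)}, e^{(j)} are the i-th and j-th standard unit vectors in ℝ^n and e is the all-ones vector, is doubly nonnegative but not completely positive. -/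
open Finset

/-- The contraction `T x^{m-1}` of the rank-one tensor `T = v^m` is `(v · x)^{m-1} v`. -/
lemma tmulVec_rankOne {m n : ℕ} [NeZero m] (v x : Fin n → ℝ) (k : Fin n) :
    tmulVec (fun g : Fin m → Fin n => ∏ t, v (g t)) x k
      = v k * (∑ l, v l * x l) ^ (m - 1) := by
  classical
  set f : Fin m → Fin n → ℝ :=
    fun t l => if t = 0 then (if l = k then v l else 0) else v l * x l with hf
  have hsum : ∑ g : Fin m → Fin n, ∏ t, f t (g t) = ∏ t, ∑ l, f t l := by
    rw [Finset.prod_univ_sum, Fintype.piFinset_univ]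
  have hprod : ∏ t, ∑ l, f t l = v k * (∑ l, v l * x l) ^ (m - 1) := by
    rw [← Finset.mul_prod_erase univ _ (mem_univ (0 : Fin m))]
    congr 1
    · simp [hf]
    · rw [Finset.prod_congr rfl (g := fun _ => ∑ l, v l * x l)]
      · simp [Finset.card_erase_of_mem]
      · intro t ht
        simp [hf, Finset.ne_of_mem_erase ht]
  rw [← hprod, ← hsum, tmulVec]
  refine Finset.sum_congr rfl fun g _ => ?_
  have hrest : ∏ t ∈ univ.erase 0, f t (g t)
      = (∏ t ∈ univ.erase 0, v (g t)) * ∏ t ∈ univ.erase 0, x (g t) := by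
    rw [← Finset.prod_mul_distrib]
    exact Finset.prod_congr rfl fun t ht => by simp [hf, Finset.ne_of_mem_erase ht]
  rw [← Finset.mul_prod_erase univ (fun t => f t (g t)) (mem_univ (0 : Fin m)),
    ← Finset.mul_prod_erase univ (fun t => v (g t)) (mem_univ (0 : Fin m)),
    hrest]
  by_cases h : g 0 = k <;> simp [hf, h, mul_assoc]

/-- The contraction of `α v^m + α e^m`, with `e` the all-ones vector. -/
lemma tmulVec_rankOne_add_ones {m n : ℕ} [NeZero m] (α : ℝ) (v x : Fin n → ℝ) (k : Fin n) :
    tmulVec (fun g : Fin m → Fin n => α * ∏ t, v (g t) + α) x k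
      = α * (v k * (∑ l, v l * x l) ^ (m - 1)) + α * (∑ l, x l) ^ (m - 1) := by
  have h := tmulVec_rankOne (m := m) (fun _ => 1) x k
  simp only [one_mul] at h
  rw [← tmulVec_rankOne, ← h, tmulVec, tmulVec, tmulVec, Finset.mul_sum, Finset.mul_sum,
    ← Finset.sum_add_distrib]
  refine Finset.sum_congr rfl fun g _ => ?_
  split_ifs
  · simp only [Finset.prod_const_one]
    ring
  · ring

/-- If `v` has a coordinate equal to `1`, then `α v^m + α e^m` with `α > 0` has no negative
H-eigenvalue. -/
lemma IsHEigenvalue.nonneg_of_rankOne_add_ones {m n : ℕ} [NeZero m] (hm : 2 ≤ m) {α : ℝ}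
    (hα : 0 < α) {v : Fin n → ℝ} {i : Fin n} (hi : v i = 1) {lam : ℝ}
    (h : IsHEigenvalue (fun g : Fin m → Fin n => α * ∏ t, v (g t) + α) lam) : 0 ≤ lam := by
  obtain ⟨x, hx, hlam⟩ := h
  simp only [tmulVec_rankOne_add_ones] at hlam
  obtain ⟨k, hk⟩ := Function.ne_iff.mp hx
  by_contra! hneg
  set a := ∑ l, v l * x l with ha
  set s := ∑ l, x l with hs
  rcases Nat.even_or_odd m with hev | hodd
  · have hpow (y : ℝ) : y * y ^ (m - 1) = y ^ m := mul_pow_sub_one (by omega) y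
    have hcontr : α * a ^ m + α * s ^ m = lam * ∑ l, x l ^ m := by
      rw [← hpow a, ← hpow s]
      nth_rewrite 1 [ha]
      nth_rewrite 2 [hs]
      rw [Finset.sum_mul, Finset.sum_mul, Finset.mul_sum, Finset.mul_sum, Finset.mul_sum,
        ← Finset.sum_add_distrib]
      refine Finset.sum_congr rfl fun l _ => ?_
      rw [← hpow (x l)]
      linear_combination x l * hlam l
    have hpos : 0 < ∑ l, x l ^ m :=
      Finset.sum_pos' (fun l _ => hev.pow_nonneg _) ⟨k, mem_univ k, hev.pow_pos hk⟩
    have := mul_nonneg hα.le (hev.pow_nonneg a)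
    have := mul_nonneg hα.le (hev.pow_nonneg s)
    linarith [mul_neg_of_neg_of_pos hneg hpos]
  · have hev : Even (m - 1) := Nat.Odd.sub_odd hodd odd_one
    have h1 := hlam i
    rw [hi, one_mul] at h1
    have ha0 := mul_nonneg hα.le (hev.pow_nonneg a)
    have hs0 := mul_nonneg hα.le (hev.pow_nonneg s)
    have hle := mul_nonpos_of_nonpos_of_nonneg hneg.le (hev.pow_nonneg (x i))
    have ha' : a ^ (m - 1) = 0 := by
      have : α * a ^ (m - 1) = 0 := by linarith
      exact (mul_eq_zero.mp this).resolve_left hα.ne'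
    have hs' : s ^ (m - 1) = 0 := by
      have : α * s ^ (m - 1) = 0 := by linarith
      exact (mul_eq_zero.mp this).resolve_left hα.ne'
    have hk' := hlam k
    rw [ha', hs'] at hk'
    linarith [mul_neg_of_neg_of_pos hneg (hev.pow_pos hk)]

/-- In a completely positive tensor, a vanishing entry forces every entry whose index tuple
contains the same indices to vanish. -/
lemma IsCP.eq_zero_of_range_subset {m n : ℕ} {A : (Fin m → Fin n) → ℝ} (hA : IsCP A)
    {g h : Fin m → Fin n} (hg : A g = 0) (hgh : Set.range g ⊆ Set.range h) : A h = 0 := by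
  obtain ⟨r, u, hu, hAu⟩ := hA
  rw [hAu, Finset.sum_eq_zero_iff_of_nonneg
    (fun k _ => Finset.prod_nonneg fun t _ => hu k (g t))] at hg
  rw [hAu]
  refine Finset.sum_eq_zero fun k hk => ?_
  obtain ⟨t, -, ht⟩ := Finset.prod_eq_zero_iff.mp (hg k hk)
  obtain ⟨t', ht'⟩ := hgh ⟨t, rfl⟩
  exact Finset.prod_eq_zero (mem_univ t') (by rw [ht', ht])

/-- for m ≥ 3, n ≥ 2, i ≠ j and α > 0, the tensor
α (eⁱ - eʲ)^m + α e^m is doubly nonnegative but not completely positive. -/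
theorem gap_tensor_DNN_not_CP (m n : ℕ) [NeZero m] (hm : 3 ≤ m) (hn : 2 ≤ n)
    (i j : Fin n) (hij : i ≠ j) (α : ℝ) (hα : 0 < α) :
    IsDNN (fun g : Fin m → Fin n =>
      α * ∏ t, ((if g t = i then (1 : ℝ) else 0) - (if g t = j then (1 : ℝ) else 0)) + α) ∧
    ¬ IsCP (fun g : Fin m → Fin n =>
      α * ∏ t, ((if g t = i then (1 : ℝ) else 0) - (if g t = j then (1 : ℝ) else 0)) + α) := by
  refine ⟨⟨fun g => ?_, fun lam h => ?_⟩, fun hcp => ?_⟩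
  · have habs : |∏ t, ((if g t = i then (1 : ℝ) else 0) - (if g t = j then (1 : ℝ) else 0))|
        ≤ 1 := by
      rw [Finset.abs_prod]
      refine Finset.prod_le_one (fun _ _ => abs_nonneg _) fun t _ => ?_
      split_ifs <;> norm_num
    nlinarith [(abs_le.mp habs).1]
  · exact IsHEigenvalue.nonneg_of_rankOne_add_ones (by omega) hα (i := i)
      (v := fun l => (if l = i then (1 : ℝ) else 0) - (if l = j then (1 : ℝ) else 0))
      (by simp [hij]) h
  · obtain ⟨p, rfl⟩ : ∃ p, m = p + 3 := ⟨m - 3, by omega⟩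
    have h := hcp.eq_zero_of_range_subset (g := Fin.cons j fun _ => i)
      (h := Fin.cons j (Fin.cons j fun _ => i))
      (by simp [Fin.prod_univ_succ, hij, hij.symm])
      (by simp [Fin.range_cons])
    simp [Fin.prod_univ_succ, hij, hij.symm] at h
    linarith
end

section
/- Let c = (c_1,...,c_n)^T ∈ ℝ^n with c_i ≠ 0 for all i, suppose c_{i_1} + ··· + c_{i_m} ≠ 0 for all index tuples, and let C be the m-th order n-dimensional symmetric Cauchy tensor with entries c_{i_1...i_m} = 1/(c_{i_1} + ··· + c_{i_m}). Then the following are equivalent: (i) C is completely positive; (ii) C is strictly copositive; (iii) c_i > 0 for all i; (iv) the function f(x) = C x^m is strictly monotonically increasing on ℝ^n_+, i.e., f(x) > f(y) whenever x, y ∈ ℝ^n_+, x ≥ y componentwise, and x ≠ y; (v) C is doubly nonnegative. -/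
open Finset

/-- The symmetric Cauchy tensor generated by c : entries 1/(c_{i_1} + ... + c_{i_m}). -/
noncomputable def cauchyTensor (m n : ℕ) (c : Fin n → ℝ) : (Fin m → Fin n) → ℝ :=
  fun g => 1 / ∑ j, c (g j)

/-- In a finite-dimensional space, the convex hull of a compact set is compact. -/
theorem IsCompact.convexHull_of_finiteDimensional {E : Type*} [NormedAddCommGroup E]
    [NormedSpace ℝ E] [FiniteDimensional ℝ E] {s : Set E} (hs : IsCompact s) :
    IsCompact (convexHull ℝ s) := by
  rcases s.eq_empty_or_nonempty with rfl | ⟨s₀, hs₀⟩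
  · simp
  let d := Module.finrank ℝ E + 1
  have hK : IsCompact (stdSimplex ℝ (Fin d) ×ˢ (Set.univ.pi fun _ : Fin d => s)) :=
    (isCompact_stdSimplex ℝ (Fin d)).prod (isCompact_univ_pi fun _ => hs)
  have hF : Continuous fun p : (Fin d → ℝ) × (Fin d → E) => ∑ i, p.1 i • p.2 i := by fun_prop
  convert hK.image hF using 1
  ext x
  constructor
  · intro hx
    obtain ⟨ι, _, z, w, hz, hind, hw, hw1, rfl⟩ := eq_pos_convex_span_of_mem_convexHull hx
    have hcard : Fintype.card ι ≤ Fintype.card (Fin d) := by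
      simpa [d] using hind.card_le_finrank_succ.trans
        (Nat.succ_le_succ (Submodule.finrank_le _))
    obtain ⟨e⟩ := Function.Embedding.nonempty_of_card_le hcard
    have hwe : ∀ i, Function.extend e w 0 (e i) = w i := e.injective.extend_apply w 0
    have hze : ∀ i, Function.extend e z (fun _ => s₀) (e i) = z i := e.injective.extend_apply z _
    refine ⟨(Function.extend e w 0, Function.extend e z fun _ => s₀), ⟨⟨fun j => ?_, ?_⟩, ?_⟩, ?_⟩
    · by_cases hj : ∃ i, e i = j
      · obtain ⟨i, rfl⟩ := hj
        simpa only [hwe] using (hw i).le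
      · simp [Function.extend_apply' _ _ _ hj]
    · rw [← hw1]
      refine (Fintype.sum_of_injective e e.injective _ _ (fun j hj => ?_) fun i => ?_).symm
      · simp [Function.extend_apply' _ _ _ hj]
      · exact (hwe i).symm
    · intro j _
      by_cases hj : ∃ i, e i = j
      · obtain ⟨i, rfl⟩ := hj
        simpa only [hze] using hz ⟨i, rfl⟩
      · simpa [Function.extend_apply' _ _ _ hj] using hs₀
    · refine (Fintype.sum_of_injective e e.injective _ _ (fun j hj => ?_) fun i => ?_).symm
      · simp [Function.extend_apply' _ _ _ hj]
      · simp only [hwe, hze]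
  · rintro ⟨⟨w, z⟩, ⟨⟨hw, hw1⟩, hz⟩, rfl⟩
    exact (convex_convexHull ℝ s).sum_mem (fun i _ => hw i) hw1
      fun i _ => subset_convexHull ℝ s (hz i (Set.mem_univ i))

theorem isCP_of_mem_convexHull {m n : ℕ} [NeZero m] {A : (Fin m → Fin n) → ℝ}
    (hA : A ∈ convexHull ℝ {B | ∃ u : Fin n → ℝ, (∀ i, 0 ≤ u i) ∧ B = fun g => ∏ t, u (g t)}) :
    IsCP A := by
  obtain ⟨ι, _, w, z, hw, -, hz, rfl⟩ := mem_convexHull_iff_exists_fintype.1 hA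
  choose u hu hzu using hz
  let e := Fintype.equivFin ι
  refine ⟨Fintype.card ι, fun k i => w (e.symm k) ^ ((1 : ℝ) / m) * u (e.symm k) i,
    fun k i => mul_nonneg (Real.rpow_nonneg (hw _) _) (hu _ _), fun g => ?_⟩
  rw [Finset.sum_apply, ← e.symm.sum_comp]
  refine Finset.sum_congr rfl fun k _ => ?_
  rw [Finset.prod_mul_distrib, Finset.prod_const, Finset.card_univ, Fintype.card_fin,
    ← Real.rpow_natCast, ← Real.rpow_mul (hw _), one_div,
    inv_mul_cancel₀ (Nat.cast_ne_zero.2 (NeZero.ne m)), Real.rpow_one, hzu]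
  rfl

open MeasureTheory in
/-- The integral representation `1 / s = ∫₀¹ N τ ^ (N s - 1) dτ` writes a Cauchy tensor with
positive generators as an average of a compact curve of `m`-th powers of nonnegative vectors. -/
theorem isCP_cauchyTensor {m n : ℕ} [NeZero m] {c : Fin n → ℝ} (hc : ∀ i, 0 < c i) :
    IsCP (cauchyTensor m n c) := by
  have hm : (m : ℝ) ≠ 0 := Nat.cast_ne_zero.2 (NeZero.ne m)
  have hm1 : (1 : ℝ) ≤ m := Nat.one_le_cast.2 (NeZero.one_le)
  obtain ⟨N, hN, hNc⟩ : ∃ N : ℝ, 0 < N ∧ ∀ i, 0 ≤ N * c i - 1 / m := by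
    have hnonneg : ∀ i, 0 ≤ (c i)⁻¹ := fun i => (inv_pos.2 (hc i)).le
    refine ⟨1 + ∑ i, (c i)⁻¹,
      add_pos_of_pos_of_nonneg one_pos (Finset.sum_nonneg fun i _ => hnonneg i),
      fun i => ?_⟩
    have h1 : (c i)⁻¹ ≤ ∑ i, (c i)⁻¹ :=
      Finset.single_le_sum (f := fun i => (c i)⁻¹) (fun i _ => hnonneg i) (Finset.mem_univ i)
    have h2 : (c i)⁻¹ * c i = 1 := inv_mul_cancel₀ (hc i).ne'
    have h3 : 1 / (m : ℝ) ≤ 1 := by rw [div_le_one (by positivity)]; exact hm1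
    nlinarith [hc i]
  let u : ℝ → Fin n → ℝ := fun τ i => N ^ ((1 : ℝ) / m) * τ ^ (N * c i - 1 / m)
  let v : ℝ → (Fin m → Fin n) → ℝ := fun τ g => ∏ t, u τ (g t)
  have hv : Continuous v := by
    have hu : ∀ i, Continuous fun τ => u τ i := fun i =>
      continuous_const.mul (Real.continuous_rpow_const (hNc i))
    exact continuous_pi fun g => continuous_finsetProd _ fun t _ => hu (g t)
  have hvint : ∀ g, Integrable (fun τ => v τ g) (volume.restrict (Set.Ioc (0 : ℝ) 1)) := fun g =>
    (((continuous_apply g).comp hv).integrableOn_Icc (a := 0) (b := 1)).mono_set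
      Set.Ioc_subset_Icc_self
  have : IsProbabilityMeasure (volume.restrict (Set.Ioc (0 : ℝ) 1)) := ⟨by simp⟩
  have hval : cauchyTensor m n c = ∫ τ in Set.Ioc (0 : ℝ) 1, v τ := by
    ext g
    have hs : 0 < ∑ t, c (g t) := Finset.sum_pos (fun t _ => hc _) Finset.univ_nonempty
    have hvg : ∀ τ ∈ Set.Ioc (0 : ℝ) 1, v τ g = N * τ ^ (N * ∑ t, c (g t) - 1) := by
      intro τ hτ
      simp only [v, u]
      rw [Finset.prod_mul_distrib, ← Real.rpow_sum_of_pos hτ.1, Finset.prod_const,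
        Finset.card_univ, Fintype.card_fin, ← Real.rpow_natCast, ← Real.rpow_mul hN.le,
        one_div_mul_cancel hm, Real.rpow_one, Finset.sum_sub_distrib, Finset.mul_sum]
      simp [hm]
    rw [eval_integral hvint, setIntegral_congr_fun measurableSet_Ioc hvg,
      integral_const_mul, ← intervalIntegral.integral_of_le zero_le_one,
      integral_rpow (Or.inl (by nlinarith [mul_pos hN hs])), sub_add_cancel, Real.one_rpow,
      Real.zero_rpow (mul_pos hN hs).ne', cauchyTensor]
    field_simp
    simp
  have hcompact : IsCompact (convexHull ℝ (v '' Set.Icc 0 1)) :=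
    (isCompact_Icc.image hv).convexHull_of_finiteDimensional
  refine isCP_of_mem_convexHull (convexHull_mono ?_ (hval ▸ (convex_convexHull ℝ _).integral_mem
    hcompact.isClosed ?_ (Integrable.of_eval hvint)))
  · rintro _ ⟨τ, hτ, rfl⟩
    exact ⟨u τ, fun i => mul_nonneg (Real.rpow_nonneg hN.le _) (Real.rpow_nonneg hτ.1 _), rfl⟩
  · filter_upwards [ae_restrict_mem measurableSet_Ioc] with τ hτ
    exact subset_convexHull ℝ _ ⟨τ, Set.Ioc_subset_Icc_self hτ, rfl⟩

theorem tmulVec_eq_of_sum_prod {m n r : ℕ} [NeZero m] {A : (Fin m → Fin n) → ℝ}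
    {u : Fin r → Fin n → ℝ} (hA : ∀ g, A g = ∑ k, ∏ t, u k (g t)) (x : Fin n → ℝ) (i : Fin n) :
    tmulVec A x i = ∑ k, u k i * (∑ j, u k j * x j) ^ (m - 1) := by
  have key : ∀ k, ∑ g : Fin m → Fin n, (if g 0 = i then
      (∏ t, u k (g t)) * ∏ t ∈ Finset.univ.erase (0 : Fin m), x (g t) else 0) =
      u k i * (∑ j, u k j * x j) ^ (m - 1) := by
    intro k
    let F : Fin m → Fin n → ℝ := fun t j =>
      if t = 0 then (if j = i then u k j else 0) else u k j * x j
    have hF : ∀ g : Fin m → Fin n, ∏ t ∈ Finset.univ.erase (0 : Fin m), F t (g t) =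
        ∏ t ∈ Finset.univ.erase (0 : Fin m), u k (g t) * x (g t) := fun g =>
      Finset.prod_congr rfl fun t ht => by simp [F, Finset.ne_of_mem_erase ht]
    have hFsum : ∏ t ∈ Finset.univ.erase (0 : Fin m), ∑ j, F t j =
        (∑ j, u k j * x j) ^ (m - 1) := by
      have : ∀ t ∈ Finset.univ.erase (0 : Fin m), ∑ j, F t j = ∑ j, u k j * x j :=
        fun t ht => by simp [F, Finset.ne_of_mem_erase ht]
      rw [Finset.prod_congr rfl this]
      simp
    have h0 : ∀ g : Fin m → Fin n, (if g 0 = i then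
        (∏ t, u k (g t)) * ∏ t ∈ Finset.univ.erase (0 : Fin m), x (g t) else 0) =
        ∏ t, F t (g t) := by
      intro g
      rw [← Finset.mul_prod_erase _ _ (Finset.mem_univ (0 : Fin m)),
        ← Finset.mul_prod_erase _ (fun t => F t (g t)) (Finset.mem_univ (0 : Fin m)), hF g,
        Finset.prod_mul_distrib]
      by_cases h : g 0 = i <;> simp [F, h, mul_assoc]
    rw [Finset.sum_congr rfl fun g _ => h0 g, ← Fintype.prod_sum,
      ← Finset.mul_prod_erase _ _ (Finset.mem_univ (0 : Fin m)), hFsum]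
    simp [F]
  rw [← Finset.sum_congr rfl fun k _ => key k, Finset.sum_comm, tmulVec]
  refine Finset.sum_congr rfl fun g _ => ?_
  split_ifs
  · rw [hA, Finset.sum_mul]
  · simp

theorem IsCP.isDNN {m n : ℕ} [NeZero m] {A : (Fin m → Fin n) → ℝ} (hA : IsCP A) : IsDNN A := by
  obtain ⟨r, u, hu, hA⟩ := hA
  refine ⟨fun g => hA g ▸ Finset.sum_nonneg fun k _ => Finset.prod_nonneg fun _ _ => hu _ _, ?_⟩
  rintro lam ⟨x, hx, heig⟩
  obtain ⟨i, hi⟩ := Function.ne_iff.1 hx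
  simp only [tmulVec_eq_of_sum_prod hA] at heig
  rcases Nat.even_or_odd (m - 1) with hm | hm
  · refine nonneg_of_mul_nonneg_left (b := x i ^ (m - 1)) ?_ (hm.pow_pos hi)
    rw [← heig i]
    exact Finset.sum_nonneg fun k _ => mul_nonneg (hu k i) (hm.pow_nonneg _)
  · have hmeven : Even (m - 1 + 1) := hm.add_one
    have hpos : 0 < ∑ j, x j ^ (m - 1 + 1) :=
      Finset.sum_pos' (fun j _ => hmeven.pow_nonneg _) ⟨i, Finset.mem_univ i, hmeven.pow_pos hi⟩
    refine nonneg_of_mul_nonneg_left ?_ hpos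
    have h : lam * ∑ j, x j ^ (m - 1 + 1) = ∑ k, (∑ j, u k j * x j) ^ (m - 1 + 1) := by
      calc lam * ∑ j, x j ^ (m - 1 + 1)
          = ∑ j, (∑ k, u k j * (∑ j, u k j * x j) ^ (m - 1)) * x j := by
            rw [Finset.mul_sum]
            exact Finset.sum_congr rfl fun j _ => by rw [heig j]; ring
        _ = ∑ k, ∑ j, u k j * (∑ j, u k j * x j) ^ (m - 1) * x j := by
            simp_rw [Finset.sum_mul]
            exact Finset.sum_comm
        _ = ∑ k, (∑ j, u k j * x j) ^ (m - 1 + 1) := by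
            refine Finset.sum_congr rfl fun k _ => ?_
            rw [pow_succ, Finset.mul_sum]
            exact Finset.sum_congr rfl fun j _ => by ring
    rw [h]
    exact Finset.sum_nonneg fun k _ => hmeven.pow_nonneg _

theorem cauchyTensor_const {m n : ℕ} (c : Fin n → ℝ) (i : Fin n) :
    cauchyTensor m n c (fun _ => i) = 1 / (m * c i) := by
  simp [cauchyTensor]

theorem cauchyTensor_pos {m n : ℕ} [NeZero m] {c : Fin n → ℝ} (hc : ∀ i, 0 < c i)
    (g : Fin m → Fin n) : 0 < cauchyTensor m n c g :=
  one_div_pos.2 (Finset.sum_pos (fun _ _ => hc _) Finset.univ_nonempty)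

theorem pos_of_cauchyTensor_const_nonneg {m n : ℕ} [NeZero m] {c : Fin n → ℝ} {i : Fin n}
    (hi : c i ≠ 0) (h : 0 ≤ cauchyTensor m n c fun _ => i) : 0 < c i := by
  rw [cauchyTensor_const, one_div_nonneg] at h
  have hm : (0 : ℝ) < m := Nat.cast_pos.2 (NeZero.pos m)
  exact lt_of_le_of_ne (nonneg_of_mul_nonneg_right h hm) hi.symm

/-- for a symmetric Cauchy tensor C with generating vector c (with all
c_i ≠ 0 and all index sums nonzero), the following are equivalent: (i) C is completely
positive; (ii) C is strictly copositive; (iii) c > 0; (iv) x ↦ C x^m is strictly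
monotonically increasing on ℝⁿ₊; (v) C is doubly nonnegative. -/
theorem cauchy_tensor_tfae (m n : ℕ) [NeZero m] (c : Fin n → ℝ)
    (hc : ∀ i, c i ≠ 0) (hsum : ∀ g : Fin m → Fin n, ∑ j, c (g j) ≠ 0) :
    List.TFAE
      [IsCP (cauchyTensor m n c),
       ∀ x : Fin n → ℝ, (∀ i, 0 ≤ x i) → x ≠ 0 →
         0 < ∑ g : Fin m → Fin n, cauchyTensor m n c g * ∏ t, x (g t),
       ∀ i, 0 < c i,
       ∀ x y : Fin n → ℝ, (∀ i, 0 ≤ x i) → (∀ i, 0 ≤ y i) → (∀ i, y i ≤ x i) → x ≠ y →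
         (∑ g : Fin m → Fin n, cauchyTensor m n c g * ∏ t, y (g t)) <
           ∑ g : Fin m → Fin n, cauchyTensor m n c g * ∏ t, x (g t),
       IsDNN (cauchyTensor m n c)] := by
  tfae_have 3 → 1 := isCP_cauchyTensor
  tfae_have 1 → 5 := IsCP.isDNN
  tfae_have 5 → 3 := fun h i => pos_of_cauchyTensor_const_nonneg (hc i) (h.1 _)
  tfae_have 3 → 4 := by
    intro hpos x y hx hy hyx hne
    obtain ⟨i, hi⟩ := Function.ne_iff.1 hne
    refine Finset.sum_lt_sum (fun g _ => mul_le_mul_of_nonneg_left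
      (Finset.prod_le_prod (fun t _ => hy _) fun t _ => hyx _) (cauchyTensor_pos hpos g).le)
      ⟨fun _ => i, Finset.mem_univ _, mul_lt_mul_of_pos_left ?_ (cauchyTensor_pos hpos _)⟩
    simpa using pow_lt_pow_left₀ (lt_of_le_of_ne (hyx i) hi.symm) (hy i) (NeZero.ne m)
  tfae_have 4 → 2 := by
    intro h x hx hx0
    simpa [NeZero.ne m] using h x 0 hx (fun _ => le_rfl) hx hx0
  tfae_have 2 → 3 := by
    intro h i
    have hi := h (Pi.single i 1) (fun j => by by_cases hj : j = i <;> simp [hj])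
      (by simp)
    rw [Finset.sum_eq_single (fun _ => i)] at hi
    · exact pos_of_cauchyTensor_const_nonneg (hc i) (by simpa using hi.le)
    · intro g _ hg
      obtain ⟨t, ht⟩ := Function.ne_iff.1 hg
      rw [Finset.prod_eq_zero (Finset.mem_univ t) (Pi.single_eq_of_ne ht 1), mul_zero]
    · simp
  tfae_finish
end
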